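/- Let a⁻ = (a₁⁻,0), a⁺ = (a₁⁺,0) with a₁⁻ < a₁⁺, and let A_{a⁻,a⁺}(x) = −(1/2)(−x₂, x₁−a₁⁻)/((x₁−a₁⁻)²+x₂²) + (1/2)(−x₂, x₁−a₁⁺)/((x₁−a₁⁺)²+x₂²). Then there exists a unique smooth function φ on ℝ² \ ([a₁⁻,a₁⁺]×{0}) with ∇φ = A_{a⁻,a⁺} and φ(x₁,0) = 0 for x₁ > a₁⁺; moreover φ∘σ = −φ, where σ(x₁,x₂) = (x₁,−x₂). -/

import Mathlib

open MeasureTheory Metric Set Filter Asymptotics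
open scoped Topology Real

noncomputable section

/-- Euclidean space `ℝⁿ`. -/
abbrev Euc (n : ℕ) := EuclideanSpace ℝ (Fin n)

/-- Model for membership in `H¹₀(Ω)`: smooth functions compactly supported in `Ω`. -/
def IsTest {n : ℕ} (Ω : Set (Euc n)) (f : Euc n → ℝ) : Prop :=
  ContDiff ℝ (⊤ : ℕ∞) f ∧ tsupport f ⊆ Ω

/-- Dirichlet energy `∫_Ω |∇f|²`. -/
def energy {n : ℕ} (Ω : Set (Euc n)) (f : Euc n → ℝ) : ℝ :=
  ∫ x in Ω, ‖fderiv ℝ f x‖ ^ 2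

/-- Condenser capacity `Cap_Ω(K)`: infimum of the Dirichlet energy over functions in
`H¹₀(Ω)` equal to `1` in a neighbourhood of `K`. -/
def cap {n : ℕ} (Ω K : Set (Euc n)) : ℝ :=
  sInf { e : ℝ | ∃ f : Euc n → ℝ, IsTest Ω f ∧
    (∃ U, IsOpen U ∧ K ⊆ U ∧ EqOn f 1 U) ∧ e = energy Ω f }

/-- `u`-capacity `Cap_Ω(K, u)`: infimum of the Dirichlet energy over functions in
`H¹₀(Ω)` with `f - u ∈ H¹₀(Ω \ K)` (modelled as `f = u` in a neighbourhood of `K`). -/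
def capU {n : ℕ} (Ω K : Set (Euc n)) (u : Euc n → ℝ) : ℝ :=
  sInf { e : ℝ | ∃ f : Euc n → ℝ, IsTest Ω f ∧
    (∃ U, IsOpen U ∧ K ⊆ U ∧ EqOn f u U) ∧ e = energy Ω f }

/-- A family `(K_ε)` of compact sets concentrates to `K₀` if every open set containing
`K₀` contains `K_ε` for all sufficiently small `ε > 0`. -/
def Concentrates {n : ℕ} (K : ℝ → Set (Euc n)) (K₀ : Set (Euc n)) : Prop :=
  ∀ U : Set (Euc n), IsOpen U → K₀ ⊆ U → ∀ᶠ ε in 𝓝[>] (0:ℝ), K ε ⊆ U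

/-- Rayleigh quotient of `f` on `Ω`. -/
def rayleigh {n : ℕ} (Ω : Set (Euc n)) (f : Euc n → ℝ) : ℝ :=
  energy Ω f / ∫ x in Ω, (f x) ^ 2

/-- `N`-th Dirichlet eigenvalue of `-Δ` on `Ω` via the Courant–Fischer min-max principle. -/
def dirichletEig {n : ℕ} (Ω : Set (Euc n)) (N : ℕ) : ℝ :=
  sInf { t : ℝ | ∃ W : Submodule ℝ (Euc n → ℝ), Module.finrank ℝ W = N ∧
    (∀ f ∈ W, IsTest Ω f) ∧ ∀ f ∈ W, f ≠ 0 → rayleigh Ω f ≤ t }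

/-- The Laplacian as a sum of second partial derivatives. -/
def lap {n : ℕ} (u : Euc n → ℝ) (x : Euc n) : ℝ :=
  ∑ i : Fin n, fderiv ℝ (fun y => fderiv ℝ u y (EuclideanSpace.single i 1)) x
    (EuclideanSpace.single i 1)

/-- `u` is a Dirichlet eigenfunction on `Ω` with eigenvalue `lam`. -/
def IsEigenfun {n : ℕ} (Ω : Set (Euc n)) (lam : ℝ) (u : Euc n → ℝ) : Prop :=
  IsTest Ω u ∧ u ≠ 0 ∧ ∀ x ∈ Ω, - lap u x = lam * u x


/-- First component of the two-pole Aharonov–Bohm potential with circulations ∓1/2. -/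
def abA1 (am ap : ℝ) (p : ℝ × ℝ) : ℝ :=
  -(1 / 2) * (-p.2 / ((p.1 - am) ^ 2 + p.2 ^ 2)) +
    (1 / 2) * (-p.2 / ((p.1 - ap) ^ 2 + p.2 ^ 2))

/-- Second component of the two-pole Aharonov–Bohm potential with circulations ∓1/2. -/
def abA2 (am ap : ℝ) (p : ℝ × ℝ) : ℝ :=
  -(1 / 2) * ((p.1 - am) / ((p.1 - am) ^ 2 + p.2 ^ 2)) +
    (1 / 2) * ((p.1 - ap) / ((p.1 - ap) ^ 2 + p.2 ^ 2))

/-- The plane minus the closed segment joining the poles. -/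
def offSeg (am ap : ℝ) : Set (ℝ × ℝ) :=
  {p : ℝ × ℝ | ¬ (am ≤ p.1 ∧ p.1 ≤ ap ∧ p.2 = 0)}

/-- The complex number `(z - ap) * conj (z - am)`. -/
def abW (am ap : ℝ) (p : ℝ × ℝ) : ℂ :=
  ((((p.1 - ap) * (p.1 - am) + p.2 * p.2 : ℝ)) : ℂ) + ((p.2 * (ap - am) : ℝ) : ℂ) * Complex.I

lemma abW_re (am ap : ℝ) (p : ℝ × ℝ) :
    (abW am ap p).re = (p.1 - ap) * (p.1 - am) + p.2 * p.2 := by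
  simp only [abW, Complex.add_re, Complex.ofReal_re, Complex.re_ofReal_mul, Complex.I_re]
  ring

lemma abW_im (am ap : ℝ) (p : ℝ × ℝ) : (abW am ap p).im = p.2 * (ap - am) := by
  simp only [abW, Complex.add_im, Complex.ofReal_im, Complex.im_ofReal_mul, Complex.I_im]
  ring

lemma abW_mem (am ap : ℝ) (h : am < ap) (p : ℝ × ℝ) (hp : p ∈ offSeg am ap) :
    abW am ap p ∈ Complex.slitPlane := by
  rw [Complex.mem_slitPlane_iff, abW_re, abW_im]
  by_cases hy : p.2 = 0
  · left
    have hp' : ¬ (am ≤ p.1 ∧ p.1 ≤ ap ∧ p.2 = 0) := hp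
    rw [hy]
    by_cases h1 : am ≤ p.1
    · have h2 : ap < p.1 := by
        by_contra h3
        exact hp' ⟨h1, not_lt.1 h3, hy⟩
      nlinarith
    · push Not at h1
      nlinarith
  · right
    exact mul_ne_zero hy (by linarith)

lemma abW_contDiff (am ap : ℝ) : ContDiff ℝ (⊤ : ℕ∞) (abW am ap) := by
  unfold abW
  refine ContDiff.add ?_ (ContDiff.mul ?_ contDiff_const)
  · have hf : ContDiff ℝ (⊤ : ℕ∞) (fun p : ℝ × ℝ => (p.1 - ap) * (p.1 - am) + p.2 * p.2) := by fun_prop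
    exact Complex.ofRealCLM.contDiff.comp hf
  · have hf : ContDiff ℝ (⊤ : ℕ∞) (fun p : ℝ × ℝ => p.2 * (ap - am)) := by fun_prop
    exact Complex.ofRealCLM.contDiff.comp hf

lemma abW_hasFDerivAt (am ap : ℝ) (p : ℝ × ℝ) :
    HasFDerivAt (abW am ap) (Complex.ofRealCLM.comp
      ((2 * p.1 - ap - am) • ContinuousLinearMap.fst ℝ ℝ ℝ +
        (2 * p.2) • ContinuousLinearMap.snd ℝ ℝ ℝ) +
      (Complex.ofRealCLM.comp ((ap - am) • ContinuousLinearMap.snd ℝ ℝ ℝ)).smulRight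
        Complex.I) p := by
  have f1 : HasFDerivAt (fun p : ℝ × ℝ => p.1) (ContinuousLinearMap.fst ℝ ℝ ℝ) p :=
    hasFDerivAt_fst
  have f2 : HasFDerivAt (fun p : ℝ × ℝ => p.2) (ContinuousLinearMap.snd ℝ ℝ ℝ) p :=
    hasFDerivAt_snd
  have g1 : HasFDerivAt (fun p : ℝ × ℝ => (p.1 - ap) * (p.1 - am) + p.2 * p.2)
      ((2 * p.1 - ap - am) • ContinuousLinearMap.fst ℝ ℝ ℝ +
        (2 * p.2) • ContinuousLinearMap.snd ℝ ℝ ℝ) p := by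
    refine (((f1.sub_const ap).mul (f1.sub_const am)).add (f2.mul f2)).congr_fderiv ?_
    ext <;> simp <;> ring
  have g2 : HasFDerivAt (fun p : ℝ × ℝ => p.2 * (ap - am))
      ((ap - am) • ContinuousLinearMap.snd ℝ ℝ ℝ) p := f2.mul_const (ap - am)
  have k1 := Complex.ofRealCLM.hasFDerivAt.comp p g1
  have k2 := (Complex.ofRealCLM.hasFDerivAt.comp p g2).mul_const Complex.I
  refine (k1.add k2).congr_fderiv ?_
  ext <;> simp [mul_comm]

/-- The phase. -/
def abPhi (am ap : ℝ) (p : ℝ × ℝ) : ℝ := (1 / 2) * (Complex.log (abW am ap p)).im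

lemma abPhi_hasFDerivAt (am ap : ℝ) (h : am < ap) (p : ℝ × ℝ) (hp : p ∈ offSeg am ap) :
    HasFDerivAt (abPhi am ap)
          ((abA1 am ap p) • (ContinuousLinearMap.fst ℝ ℝ ℝ) +
           (abA2 am ap p) • (ContinuousLinearMap.snd ℝ ℝ ℝ)) p := by
  have hm := abW_mem am ap h p hp
  have hl := (Complex.hasStrictDerivAt_log hm).hasDerivAt.hasFDerivAt.restrictScalars ℝ
  have k := ((Complex.imCLM.hasFDerivAt.comp p (hl.comp p (abW_hasFDerivAt am ap p))).const_mul
    (1 / 2 : ℝ))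
  have hp' : ¬ (am ≤ p.1 ∧ p.1 ≤ ap ∧ p.2 = 0) := hp
  have hd1 : (p.1 - am) ^ 2 + p.2 ^ 2 ≠ 0 := by
    intro h0
    have e1 : p.1 - am = 0 := by nlinarith [sq_nonneg (p.1 - am), sq_nonneg p.2]
    have e2 : p.2 = 0 := by nlinarith [sq_nonneg (p.1 - am), sq_nonneg p.2]
    exact hp' ⟨by linarith, by linarith, e2⟩
  have hd2 : (p.1 - ap) ^ 2 + p.2 ^ 2 ≠ 0 := by
    intro h0
    have e1 : p.1 - ap = 0 := by nlinarith [sq_nonneg (p.1 - ap), sq_nonneg p.2]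
    have e2 : p.2 = 0 := by nlinarith [sq_nonneg (p.1 - ap), sq_nonneg p.2]
    exact hp' ⟨by linarith, by linarith, e2⟩
  have hn : Complex.normSq (abW am ap p) =
      ((p.1 - am) ^ 2 + p.2 ^ 2) * ((p.1 - ap) ^ 2 + p.2 ^ 2) := by
    rw [Complex.normSq_apply, abW_re, abW_im]; ring
  refine k.congr_fderiv ?_
  ext
  · simp [abA1, Complex.inv_re, Complex.inv_im, hn, abW_re, abW_im]
    field_simp
    ring
  · simp [abA2, Complex.inv_re, Complex.inv_im, hn, abW_re, abW_im]
    field_simp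
    ring

lemma abPhi_contDiffOn (am ap : ℝ) (h : am < ap) :
    ContDiffOn ℝ (⊤ : ℕ∞) (abPhi am ap) (offSeg am ap) := by
  intro p hp
  have hm := abW_mem am ap h p hp
  have hl : ContDiffAt ℝ (⊤ : ℕ∞) Complex.log (abW am ap p) :=
    (Complex.contDiffAt_log hm).restrict_scalars ℝ
  have h2 : ContDiffAt ℝ (⊤ : ℕ∞) (fun q => Complex.log (abW am ap q)) p :=
    hl.comp p (abW_contDiff am ap).contDiffAt
  have h3 : ContDiffAt ℝ (⊤ : ℕ∞) (fun q => (Complex.log (abW am ap q)).im) p :=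
    Complex.imCLM.contDiff.contDiffAt.comp p h2
  exact (contDiffAt_const.mul h3).contDiffWithinAt

lemma abPhi_zero (am ap : ℝ) (h : am < ap) (x : ℝ) (hx : ap < x) : abPhi am ap (x, 0) = 0 := by
  have : (abW am ap (x, 0)).arg = 0 := by
    rw [Complex.arg_eq_zero_iff, abW_re, abW_im]
    constructor
    · simp only
      nlinarith
    · simp
  simp [abPhi, Complex.log_im, this]

lemma abPhi_neg (am ap : ℝ) (h : am < ap) (p : ℝ × ℝ) (hp : p ∈ offSeg am ap) :
    abPhi am ap (p.1, -p.2) = - abPhi am ap p := by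
  have hm := abW_mem am ap h p hp
  have hc : abW am ap (p.1, -p.2) = (starRingEnd ℂ) (abW am ap p) := by
    apply Complex.ext
    · rw [Complex.conj_re, abW_re, abW_re]; ring
    · rw [Complex.conj_im, abW_im, abW_im]; ring
  have := Complex.slitPlane_arg_ne_pi hm
  rw [abPhi, abPhi, hc, Complex.log_im, Complex.log_im, Complex.arg_conj, if_neg this]
  ring

lemma ab_const (am ap : ℝ) (g : ℝ × ℝ → ℝ)
    (hg : ∀ p ∈ offSeg am ap, HasFDerivAt g (0 : ℝ × ℝ →L[ℝ] ℝ) p)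
    (s : Set (ℝ × ℝ)) (hs : IsOpen s) (hc : Convex ℝ s) (hsub : s ⊆ offSeg am ap)
    (p q : ℝ × ℝ) (hp : p ∈ s) (hq : q ∈ s) : g p = g q :=
  hs.is_const_of_fderiv_eq_zero hc.isPreconnected
    (fun x hx => (hg x (hsub hx)).differentiableAt.differentiableWithinAt)
    (fun x hx => (hg x (hsub hx)).fderiv) hp hq

lemma ab_zero (am ap : ℝ) (g : ℝ × ℝ → ℝ)
    (hg : ∀ p ∈ offSeg am ap, HasFDerivAt g (0 : ℝ × ℝ →L[ℝ] ℝ) p)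
    (h0 : ∀ x : ℝ, ap < x → g (x, 0) = 0) (p : ℝ × ℝ) (hp : p ∈ offSeg am ap) : g p = 0 := by
  have l1 : IsLinearMap ℝ (fun p : ℝ × ℝ => p.1) := (LinearMap.fst ℝ ℝ ℝ).isLinear
  have l2 : IsLinearMap ℝ (fun p : ℝ × ℝ => p.2) := (LinearMap.snd ℝ ℝ ℝ).isLinear
  have R := ab_const am ap g hg {p | ap < p.1} (isOpen_lt continuous_const continuous_fst)
    (convex_halfSpace_gt l1 ap)
    (fun q hq hh => absurd hh.2.1 (not_le.2 hq))
  have L := ab_const am ap g hg {p | p.1 < am} (isOpen_lt continuous_fst continuous_const)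
    (convex_halfSpace_lt l1 am)
    (fun q hq hh => absurd hh.1 (not_le.2 hq))
  have U := ab_const am ap g hg {p | 0 < p.2} (isOpen_lt continuous_const continuous_snd)
    (convex_halfSpace_gt l2 0)
    (fun q hq hh => absurd hh.2.2 (ne_of_gt hq))
  have D := ab_const am ap g hg {p | p.2 < 0} (isOpen_lt continuous_snd continuous_const)
    (convex_halfSpace_lt l2 0)
    (fun q hq hh => absurd hh.2.2 (ne_of_lt hq))
  have z : g (ap + 1, 0) = 0 := h0 _ (by linarith)
  have hR : ∀ y : ℝ, g (ap + 1, y) = 0 := fun y => by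
    rw [← z]
    exact R _ _ (by simp) (by simp)
  have hU : ∀ q : ℝ × ℝ, 0 < q.2 → g q = 0 := fun q hq => by
    rw [← hR 1]
    exact U _ _ hq (by simp)
  have hD : ∀ q : ℝ × ℝ, q.2 < 0 → g q = 0 := fun q hq => by
    rw [← hR (-1)]
    exact D _ _ hq (by simp)
  rcases lt_trichotomy p.2 0 with hy | hy | hy
  · exact hD p hy
  · by_cases h1 : am ≤ p.1
    · have h2 : ap < p.1 := by
        by_contra h3
        exact hp ⟨h1, not_lt.1 h3, hy⟩
      rw [← z]
      exact R _ _ h2 (by simp)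
    · push Not at h1
      rw [← hU (p.1, 1) (by simp)]
      exact L _ _ h1 h1
  · exact hU p hy

/-- there is a unique smooth φ on ℝ² minus the segment joining the poles with
∇φ = A_{a⁻,a⁺} and φ(x₁,0) = 0 for x₁ > a₁⁺; moreover φ ∘ σ = −φ. -/
theorem stmt_17 (am ap : ℝ) (h : am < ap) :
    ∃ φ : ℝ × ℝ → ℝ,
      (ContDiffOn ℝ (⊤ : ℕ∞) φ (offSeg am ap) ∧
       (∀ p ∈ offSeg am ap, HasFDerivAt φ
          ((abA1 am ap p) • (ContinuousLinearMap.fst ℝ ℝ ℝ) +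
           (abA2 am ap p) • (ContinuousLinearMap.snd ℝ ℝ ℝ)) p) ∧
       (∀ x₁ : ℝ, ap < x₁ → φ (x₁, 0) = 0)) ∧
      (∀ φ' : ℝ × ℝ → ℝ,
        (ContDiffOn ℝ (⊤ : ℕ∞) φ' (offSeg am ap) ∧
         (∀ p ∈ offSeg am ap, HasFDerivAt φ'
            ((abA1 am ap p) • (ContinuousLinearMap.fst ℝ ℝ ℝ) +
             (abA2 am ap p) • (ContinuousLinearMap.snd ℝ ℝ ℝ)) p) ∧
         (∀ x₁ : ℝ, ap < x₁ → φ' (x₁, 0) = 0)) →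
        EqOn φ' φ (offSeg am ap)) ∧
      (∀ p ∈ offSeg am ap, φ (p.1, -p.2) = - φ p) := by
  refine ⟨abPhi am ap, ⟨abPhi_contDiffOn am ap h, abPhi_hasFDerivAt am ap h, abPhi_zero am ap h⟩,
    ?_, abPhi_neg am ap h⟩
  rintro φ' ⟨-, hd, hz⟩ p hp
  have := ab_zero am ap (fun q => φ' q - abPhi am ap q)
    (fun q hq => ((hd q hq).sub (abPhi_hasFDerivAt am ap h q hq)).congr_fderiv (sub_self _))
    (fun x hx => by simp only [hz x hx, abPhi_zero am ap h x hx, sub_self]) p hp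
  exact sub_eq_zero.1 this
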